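/- For every integer n ≥ 1, every real λ with 0 < λ ≤ 1/2, and every z ∈ {0,…,2^{n+1}−1}, the coefficient matrix M_z of the embedded bipartite pure state |ψ_z^{(n,λ)}⟩, defined by M_z(x,y) = sqrt( 2^{n+1} · b^{(n,λ)}(x,y,z) ), has exactly two nonzero entries, with values √λ and √(1−λ), lying in distinct rows and distinct columns; consequently rank(M_z) = 2 (the state has Schmidt rank 2), the nonzero eigenvalues of M_z M_z^H are exactly λ and 1−λ, and hence each |ψ_z^{(n,λ)}⟩ has entanglement entropy h(λ) = −λ·log₂ λ − (1−λ)·log₂(1−λ). -/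

import Mathlib

/-- The "fold" permutation σ_t : shifts odd values by ±t (within blocks of size 2t),
fixes even values. -/
def origamiSig (t k : ℕ) : ℕ :=
  if k % 2 = 1 then (if k % (2 * t) < t then k + t else k - t) else k

/-- The map producing the new block `T_n` from `S_n`. -/
def origamiFold (n : ℕ) (s : Finset (ℕ × ℕ × ℕ)) : Finset (ℕ × ℕ × ℕ) :=
  if n % 2 = 1 then
    s.image (fun p =>
      (p.1 + 2 ^ ((n + 3) / 2), origamiSig (2 ^ ((n + 1) / 2)) p.2.1, p.2.2 + 2 ^ (n + 1)))
  else
    s.image (fun p =>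
      (origamiSig (2 ^ (n / 2 + 1)) p.1, p.2.1 + 2 ^ (n / 2 + 1), p.2.2 + 2 ^ (n + 1)))

/-- The support `S_n` of the origami distribution. -/
def origamiS : ℕ → Finset (ℕ × ℕ × ℕ)
  | 0 => ∅
  | 1 => {(0,0,0), (1,1,0), (3,0,1), (2,1,1), (0,2,2), (3,3,2), (2,3,3), (1,2,3)}
  | (n + 2) => origamiS (n + 1) ∪ origamiFold (n + 1) (origamiS (n + 1))

/-- The origami distribution `b^{(n,λ)}` on ℕ³: probability `2^{-(n+1)}·λ` on points of
`S_n` with even `x`, `2^{-(n+1)}·(1-λ)` on points of `S_n` with odd `x`, and `0` elsewhere. -/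
noncomputable def origamiB (n : ℕ) (lam : ℝ) (p : ℕ × ℕ × ℕ) : ℝ :=
  if p ∈ origamiS n then (if p.1 % 2 = 0 then lam else 1 - lam) / 2 ^ (n + 1) else 0

open Matrix

/-- The coefficient matrix `M_z` of the embedded pure state `|ψ_z^{(n,λ)}⟩`, with
`M_z(x,y) = sqrt(2^{n+1} · b^{(n,λ)}(x,y,z))`. -/
noncomputable def origamiM (n : ℕ) (lam : ℝ) (z : ℕ) :
    Matrix (Fin (2 ^ (n / 2 + 2))) (Fin (2 ^ ((n + 1) / 2 + 1))) ℝ :=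
  fun x y => Real.sqrt (2 ^ (n + 1) * origamiB n lam ((x : ℕ), (y : ℕ), z))

/-- The entropy summand `x ↦ -x log₂ x` (with value `0` at `0`). -/
noncomputable def entSummand (x : ℝ) : ℝ := if x = 0 then 0 else -x * Real.logb 2 x

theorem origamiSig_mod_two {t k : ℕ} (ht : t % 2 = 0) : origamiSig t k % 2 = k % 2 := by
  unfold origamiSig
  split_ifs with h1 h2
  · omega
  · have := Nat.mod_le k (2 * t)
    omega
  · rfl

theorem origamiSig_lt {t k : ℕ} (hk : k < 2 * t) : origamiSig t k < 2 * t := by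
  unfold origamiSig
  rw [Nat.mod_eq_of_lt hk]
  split_ifs <;> omega

/-- The slice `{(x, y) | (x, y, z) ∈ s}` consists of one point with even `x` and one with odd `x`,
whose `y`-coordinates have different parities, inside the box `[0, a) × [0, b)`. -/
def IsOrigamiSlice (a b : ℕ) (s : Finset (ℕ × ℕ × ℕ)) (z : ℕ) : Prop :=
  ∃ x₀ x₁ y₀ y₁ : ℕ, x₀ % 2 = 0 ∧ x₁ % 2 = 1 ∧ y₀ % 2 ≠ y₁ % 2 ∧
    x₀ < a ∧ x₁ < a ∧ y₀ < b ∧ y₁ < b ∧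
    ∀ x y, (x, y, z) ∈ s ↔ (x = x₀ ∧ y = y₀) ∨ (x = x₁ ∧ y = y₁)

/-- Gluing to `s` a copy of itself, moved above height `c` in the `z`-direction by parity
preserving maps of the `x`- and `y`-coordinates, keeps all slices of the origami shape. -/
theorem IsOrigamiSlice.union_image {a b a' b' c : ℕ} {s : Finset (ℕ × ℕ × ℕ)} {f g : ℕ → ℕ}
    (ha : a ≤ a') (hb : b ≤ b')
    (hf : ∀ x < a, f x < a') (hg : ∀ y < b, g y < b')
    (hf2 : ∀ x, f x % 2 = x % 2) (hg2 : ∀ y, g y % 2 = y % 2)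
    (hs : ∀ p ∈ s, p.2.2 < c) (h : ∀ z < c, IsOrigamiSlice a b s z) :
    (∀ p ∈ s ∪ s.image (fun p => (f p.1, g p.2.1, p.2.2 + c)), p.2.2 < 2 * c) ∧
    ∀ z < 2 * c,
      IsOrigamiSlice a' b' (s ∪ s.image (fun p => (f p.1, g p.2.1, p.2.2 + c))) z := by
  refine ⟨fun p hp => ?_, fun z hz => ?_⟩
  · rcases Finset.mem_union.1 hp with hp | hp
    · have := hs p hp
      omega
    · obtain ⟨q, hq, rfl⟩ := Finset.mem_image.1 hp
      have := hs q hq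
      dsimp only
      omega
  · rcases lt_or_ge z c with hzc | hzc
    · obtain ⟨x₀, x₁, y₀, y₁, hx₀, hx₁, hy, bx₀, bx₁, by₀, by₁, hmem⟩ := h z hzc
      refine ⟨x₀, x₁, y₀, y₁, hx₀, hx₁, hy, by omega, by omega, by omega, by omega,
        fun x y => ?_⟩
      rw [← hmem, Finset.mem_union, or_iff_left]
      intro hp
      obtain ⟨q, -, hq⟩ := Finset.mem_image.1 hp
      have : q.2.2 + c = z := congrArg (fun p => p.2.2) hq
      omega
    · obtain ⟨w, rfl⟩ := Nat.exists_eq_add_of_le' hzc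
      obtain ⟨x₀, x₁, y₀, y₁, hx₀, hx₁, hy, bx₀, bx₁, by₀, by₁, hmem⟩ := h w (by omega)
      refine ⟨f x₀, f x₁, g y₀, g y₁, by rw [hf2, hx₀], by rw [hf2, hx₁], by rwa [hg2, hg2],
        hf _ bx₀, hf _ bx₁, hg _ by₀, hg _ by₁, fun x y => ?_⟩
      rw [Finset.mem_union, or_iff_right (fun hp => by have := hs _ hp; dsimp only at this; omega),
        Finset.mem_image]
      constructor
      · rintro ⟨⟨u, v, r⟩, hq, he⟩
        simp only [Prod.mk.injEq, Nat.add_right_cancel_iff] at he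
        obtain ⟨rfl, rfl, rfl⟩ := he
        rcases (hmem u v).1 hq with ⟨rfl, rfl⟩ | ⟨rfl, rfl⟩
        · exact Or.inl ⟨rfl, rfl⟩
        · exact Or.inr ⟨rfl, rfl⟩
      · rintro (⟨rfl, rfl⟩ | ⟨rfl, rfl⟩)
        · exact ⟨(x₀, y₀, w), (hmem _ _).2 (Or.inl ⟨rfl, rfl⟩), rfl⟩
        · exact ⟨(x₁, y₁, w), (hmem _ _).2 (Or.inr ⟨rfl, rfl⟩), rfl⟩

theorem isOrigamiSlice_origamiS_one {z : ℕ} (hz : z < 4) : IsOrigamiSlice 4 4 (origamiS 1) z := by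
  interval_cases z
  · exact ⟨0, 1, 0, 1, by simp [origamiS]⟩
  · exact ⟨2, 3, 1, 0, by simp [origamiS, or_comm]⟩
  · exact ⟨0, 3, 2, 3, by simp [origamiS]⟩
  · exact ⟨2, 1, 3, 2, by simp [origamiS]⟩

theorem isOrigamiSlice_origamiS (n : ℕ) :
    (∀ p ∈ origamiS (n + 1), p.2.2 < 2 ^ (n + 2)) ∧
    ∀ z < 2 ^ (n + 2), IsOrigamiSlice (2 ^ ((n + 1) / 2 + 2)) (2 ^ ((n + 2) / 2 + 1))
      (origamiS (n + 1)) z := by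
  induction n with
  | zero => exact ⟨by decide, fun z hz => isOrigamiSlice_origamiS_one hz⟩
  | succ n ih =>
    rw [show n + 1 + 2 = n + 2 + 1 from rfl, pow_succ' 2 (n + 2)]
    obtain ⟨m, hm⟩ := Nat.even_or_odd' n
    have h2 : 2 ^ (m + 2) = 2 * 2 ^ (m + 1) := pow_succ' 2 (m + 1)
    have h3 : 2 ^ (m + 3) = 2 * 2 ^ (m + 2) := pow_succ' 2 (m + 2)
    rcases hm with rfl | rfl
    · have e : origamiS (2 * m + 1 + 1) = origamiS (2 * m + 1) ∪ (origamiS (2 * m + 1)).image (fun p =>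
          (p.1 + 2 ^ (m + 2), origamiSig (2 ^ (m + 1)) p.2.1, p.2.2 + 2 ^ (2 * m + 2))) := by
        rw [origamiS, origamiFold, if_pos (by omega), show (2 * m + 1 + 3) / 2 = m + 2 by omega,
          show (2 * m + 1 + 1) / 2 = m + 1 by omega]
      rw [show (2 * m + 1) / 2 + 2 = m + 2 by omega,
        show (2 * m + 2) / 2 + 1 = m + 2 by omega] at ih
      rw [e, show (2 * m + 1 + 1) / 2 + 2 = m + 3 by omega,
        show (2 * m + 2 + 1) / 2 + 1 = m + 2 by omega]
      refine IsOrigamiSlice.union_image (f := fun x => x + 2 ^ (m + 2))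
        (g := origamiSig (2 ^ (m + 1))) ?_ le_rfl ?_ ?_ ?_ ?_ ih.1 ih.2
      · omega
      · intro x hx
        omega
      · intro y hy
        rw [h2] at hy ⊢
        exact origamiSig_lt hy
      · intro x
        omega
      · exact fun y => origamiSig_mod_two (t := 2 ^ (m + 1)) (by rw [pow_succ]; omega)
    · have e : origamiS (2 * m + 1 + 1 + 1) = origamiS (2 * m + 1 + 1) ∪
          (origamiS (2 * m + 1 + 1)).image (fun p =>
            (origamiSig (2 ^ (m + 2)) p.1, p.2.1 + 2 ^ (m + 2), p.2.2 + 2 ^ (2 * m + 1 + 2))) := by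
        rw [origamiS, origamiFold, if_neg (by omega),
          show (2 * m + 1 + 1) / 2 + 1 = m + 2 by omega]
      rw [show (2 * m + 1 + 1) / 2 + 2 = m + 3 by omega,
        show (2 * m + 1 + 2) / 2 + 1 = m + 2 by omega] at ih
      rw [e, show (2 * m + 1 + 1 + 1) / 2 + 2 = m + 3 by omega,
        show (2 * m + 1 + 2 + 1) / 2 + 1 = m + 3 by omega]
      refine IsOrigamiSlice.union_image (f := origamiSig (2 ^ (m + 2)))
        (g := fun y => y + 2 ^ (m + 2)) le_rfl ?_ ?_ ?_ ?_ ?_ ih.1 ih.2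
      · omega
      · intro x hx
        rw [h3] at hx ⊢
        exact origamiSig_lt hx
      · intro y hy
        omega
      · exact fun x => origamiSig_mod_two (t := 2 ^ (m + 2)) (by omega)
      · intro y
        omega

theorem origamiM_apply (n : ℕ) (lam : ℝ) (z : ℕ) (x : Fin (2 ^ (n / 2 + 2)))
    (y : Fin (2 ^ ((n + 1) / 2 + 1))) :
    origamiM n lam z x y = if ((x : ℕ), (y : ℕ), z) ∈ origamiS n then
      (if (x : ℕ) % 2 = 0 then √lam else √(1 - lam)) else 0 := by
  unfold origamiM origamiB
  split_ifs
  · rw [mul_div_cancel₀ _ (by positivity)]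
  · rw [mul_div_cancel₀ _ (by positivity)]
  · simp

theorem Matrix.sum_comp_eigenvalues_of_eq_diagonal {m : Type*} [Fintype m] [DecidableEq m]
    {A : Matrix m m ℝ} (hA : A.IsHermitian) {d : m → ℝ} (h : A = diagonal d) (f : ℝ → ℝ) :
    ∑ i, f (hA.eigenvalues i) = ∑ i, f (d i) := by
  have h1 := hA.roots_charpoly_eq_eigenvalues
  have h2 : A.charpoly.roots = Finset.univ.val.map d := by
    rw [h, charpoly_diagonal, Polynomial.roots_prod _ _
      (Finset.prod_ne_zero_iff.2 fun _ _ => Polynomial.X_sub_C_ne_zero _)]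
    simp
  have h3 := congrArg (fun s => (s.map f).sum) (h1.symm.trans h2)
  simpa [Multiset.map_map] using h3

theorem Matrix.mul_conjTranspose_eq_diagonal_of_two_entries {m k : Type*} [Fintype k]
    [DecidableEq m] [DecidableEq k] {M : Matrix m k ℝ}
    {x₀ x₁ : m} {y₀ y₁ : k} (hx : x₀ ≠ x₁) (hy : y₀ ≠ y₁)
    (hM : ∀ x y, M x y ≠ 0 → (x = x₀ ∧ y = y₀) ∨ (x = x₁ ∧ y = y₁)) :
    M * Mᴴ = diagonal
      ((Pi.single x₀ (M x₀ y₀ ^ 2) : m → ℝ) + (Pi.single x₁ (M x₁ y₁ ^ 2) : m → ℝ)) := by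
  have e : M = single x₀ y₀ (M x₀ y₀) + single x₁ y₁ (M x₁ y₁) := by
    ext x y
    by_cases h : M x y = 0
    · by_cases h0 : x₀ = x ∧ y₀ = y
      · obtain ⟨rfl, rfl⟩ := h0
        simp [hx.symm]
      · by_cases h1 : x₁ = x ∧ y₁ = y
        · obtain ⟨rfl, rfl⟩ := h1
          simp [hx]
        · simp [h0, h1, h]
    · rcases hM x y h with ⟨rfl, rfl⟩ | ⟨rfl, rfl⟩
      · simp [hx.symm]
      · simp [hx]
  generalize M x₀ y₀ = p at *
  generalize M x₁ y₁ = q at *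
  subst e
  have hadd (f g : m → ℝ) : diagonal (f + g) = diagonal f + diagonal g := (diagonal_add f g).symm
  rw [hadd, diagonal_single, diagonal_single]
  simp [Matrix.add_mul, Matrix.mul_add, hy, hy.symm, sq]

/-- Each embedded origami state `|ψ_z^{(n,λ)}⟩` has exactly two nonzero coefficients
`√λ` and `√(1-λ)` in distinct rows and columns, has Schmidt rank `2`, the nonzero
eigenvalues of its reduced state `M_z M_zᴴ` are exactly `λ` and `1-λ`, and its
entanglement entropy is `h(λ)`. -/
theorem origami_state_schmidt
    (n : ℕ) (hn : 1 ≤ n) (lam : ℝ) (hlam0 : 0 < lam) (hlam1 : lam ≤ 1 / 2)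
    (z : ℕ) (hz : z < 2 ^ (n + 1)) :
    (∃ (x₀ x₁ : Fin (2 ^ (n / 2 + 2))) (y₀ y₁ : Fin (2 ^ ((n + 1) / 2 + 1))),
      x₀ ≠ x₁ ∧ y₀ ≠ y₁ ∧
      origamiM n lam z x₀ y₀ = Real.sqrt lam ∧
      origamiM n lam z x₁ y₁ = Real.sqrt (1 - lam) ∧
      (∀ x y, origamiM n lam z x y ≠ 0 → (x = x₀ ∧ y = y₀) ∨ (x = x₁ ∧ y = y₁))) ∧
    (origamiM n lam z).rank = 2 ∧
    {μ : ℝ | μ ∈ spectrum ℝ (origamiM n lam z * (origamiM n lam z)ᴴ) ∧ μ ≠ 0}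
      = {lam, 1 - lam} ∧
    (∀ hH : (origamiM n lam z * (origamiM n lam z)ᴴ).IsHermitian,
      ∑ i, entSummand (hH.eigenvalues i)
        = -lam * Real.logb 2 lam - (1 - lam) * Real.logb 2 (1 - lam)) := by
  obtain ⟨n, rfl⟩ := Nat.exists_eq_add_of_le' hn
  obtain ⟨a₀, a₁, b₀, b₁, ha₀, ha₁, hb, la₀, la₁, lb₀, lb₁, hmem⟩ :=
    (isOrigamiSlice_origamiS n).2 z hz
  have key : ∃ (x₀ x₁ : Fin (2 ^ ((n + 1) / 2 + 2))) (y₀ y₁ : Fin (2 ^ ((n + 1 + 1) / 2 + 1))),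
      x₀ ≠ x₁ ∧ y₀ ≠ y₁ ∧
      origamiM (n + 1) lam z x₀ y₀ = Real.sqrt lam ∧
      origamiM (n + 1) lam z x₁ y₁ = Real.sqrt (1 - lam) ∧
      (∀ x y, origamiM (n + 1) lam z x y ≠ 0 →
        (x = x₀ ∧ y = y₀) ∨ (x = x₁ ∧ y = y₁)) := by
    refine ⟨⟨a₀, la₀⟩, ⟨a₁, la₁⟩, ⟨b₀, lb₀⟩, ⟨b₁, lb₁⟩, ?_, ?_, ?_, ?_, fun x y hxy => ?_⟩
    · rw [Ne, Fin.mk.injEq]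
      omega
    · rw [Ne, Fin.mk.injEq]
      omega
    · rw [origamiM_apply, if_pos ((hmem _ _).2 (Or.inl ⟨rfl, rfl⟩)), if_pos ha₀]
    · rw [origamiM_apply, if_pos ((hmem _ _).2 (Or.inr ⟨rfl, rfl⟩)), if_neg (by simp [ha₁])]
    · rw [origamiM_apply] at hxy
      simpa [Fin.ext_iff] using (hmem x y).1 (by_contra fun h => hxy (if_neg h))
  refine ⟨key, ?_⟩
  obtain ⟨x₀, x₁, y₀, y₁, hx, hy, h₀, h₁, hM⟩ := key
  have hlam : 0 < 1 - lam := by linarith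
  have hD := mul_conjTranspose_eq_diagonal_of_two_entries hx hy hM
  rw [h₀, h₁, Real.sq_sqrt hlam0.le, Real.sq_sqrt hlam.le] at hD
  set d : Fin (2 ^ ((n + 1) / 2 + 2)) → ℝ := Pi.single x₀ lam + Pi.single x₁ (1 - lam) with hd
  have d₀ : d x₀ = lam := by simp [hd, hx]
  have d₁ : d x₁ = 1 - lam := by simp [hd, hx.symm]
  have dz : ∀ i, i ≠ x₀ → i ≠ x₁ → d i = 0 := fun i h0 h1 => by simp [hd, h0, h1]
  refine ⟨?_, ?_, fun hH => ?_⟩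
  · rw [← rank_self_mul_conjTranspose, hD, rank_diagonal, Fintype.card_subtype,
      show Finset.univ.filter (fun i => d i ≠ 0) = {x₀, x₁} from ?_, Finset.card_pair hx]
    ext i
    simp only [Finset.mem_filter, Finset.mem_univ, true_and, Finset.mem_insert,
      Finset.mem_singleton]
    constructor
    · intro h
      by_contra! h'
      exact h (dz i h'.1 h'.2)
    · rintro (rfl | rfl)
      · exact d₀ ▸ hlam0.ne'
      · exact d₁ ▸ hlam.ne'
  · rw [hD, spectrum_diagonal]
    ext μ
    constructor
    · rintro ⟨⟨i, rfl⟩, hi⟩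
      by_cases h0 : i = x₀
      · exact Or.inl (h0 ▸ d₀)
      · by_cases h1 : i = x₁
        · exact Or.inr (h1 ▸ d₁)
        · exact absurd (dz i h0 h1) hi
    · rintro (rfl | rfl)
      · exact ⟨⟨x₀, d₀⟩, hlam0.ne'⟩
      · exact ⟨⟨x₁, d₁⟩, hlam.ne'⟩
  · rw [sum_comp_eigenvalues_of_eq_diagonal hH hD,
      ← Finset.sum_subset (Finset.subset_univ {x₀, x₁}), Finset.sum_pair hx, d₀, d₁]
    · rw [entSummand, entSummand, if_neg hlam0.ne', if_neg hlam.ne']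
      ring
    · intro i _ hi
      simp only [Finset.mem_insert, Finset.mem_singleton, not_or] at hi
      simp [entSummand, dz i hi.1 hi.2]
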